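/- Let G = T × D < GL(V) be a finite abelian pseudo-reflection group with T the transvection subgroup and D the homology subgroup, and V = V^D ⊕ V_D the corresponding kG-module decomposition. Then k[V]^G ≅ k[V^D]^T ⊗ k[V_D]^D as graded k-algebras. Consequently, k[V]^G is a polynomial ring if and only if both k[V^D]^T and k[V_D]^D are polynomial rings. -/

import Mathlib

open MvPolynomial

set_option synthInstance.maxHeartbeats 1000000
set_option maxHeartbeats 1000000

variable {k : Type*} [Field k] {ι : Type*} [Fintype ι] [DecidableEq ι]

noncomputable def galAct (M : Matrix.GeneralLinearGroup ι k) :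
    MvPolynomial ι k →ₐ[k] MvPolynomial ι k :=
  aeval fun i => ∑ j, (((M⁻¹ : Matrix.GeneralLinearGroup ι k) : Matrix ι ι k) i j) • X j

def invariants (G : Subgroup (Matrix.GeneralLinearGroup ι k)) :
    Subalgebra k (MvPolynomial ι k) where
  carrier := {p | ∀ σ ∈ G, galAct σ p = p}
  mul_mem' := fun ha hb σ hσ => by rw [map_mul, ha σ hσ, hb σ hσ]
  add_mem' := fun ha hb σ hσ => by rw [map_add, ha σ hσ, hb σ hσ]
  algebraMap_mem' := fun r σ hσ => by simp [galAct]

noncomputable def fixedSpace (M : Matrix.GeneralLinearGroup ι k) : Submodule k (ι → k) :=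
  LinearMap.ker (Matrix.mulVecLin ((M : Matrix ι ι k) - 1))

noncomputable def moveSpace (M : Matrix.GeneralLinearGroup ι k) : Submodule k (ι → k) :=
  LinearMap.range (Matrix.mulVecLin ((M : Matrix ι ι k) - 1))

def IsPseudoReflection (M : Matrix.GeneralLinearGroup ι k) : Prop :=
  Module.finrank k (moveSpace M) = 1

def IsTransvection (M : Matrix.GeneralLinearGroup ι k) : Prop :=
  IsPseudoReflection M ∧ moveSpace M ≤ fixedSpace M

noncomputable def linForm (y : Module.Dual k (ι → k)) : MvPolynomial ι k :=
  ∑ i, C (y (Pi.single i 1)) * X i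

noncomputable def hilbertIdeal (G : Subgroup (Matrix.GeneralLinearGroup ι k)) :
    Ideal (MvPolynomial ι k) :=
  Ideal.span {p | p ∈ invariants G ∧ ∃ d, 0 < d ∧ p.IsHomogeneous d}

def DSP (G : Subgroup (Matrix.GeneralLinearGroup ι k)) : Prop :=
  ∃ π : MvPolynomial ι k →ₗ[↥(invariants G)] ↥(invariants G),
    Function.Surjective π ∧
    ∀ (p : MvPolynomial ι k) (d : ℕ), p.IsHomogeneous d →
      ((π p : MvPolynomial ι k)).IsHomogeneous d

noncomputable def fixedSubmodule (G : Subgroup (Matrix.GeneralLinearGroup ι k)) :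
    Submodule k (ι → k) := ⨅ σ ∈ G, fixedSpace σ

/-- The block-diagonal embedding `GL(V^D) × GL(V_D) → GL(V^D ⊕ V_D)`. -/
noncomputable def blockHom {k : Type*} [Field k] {α β : Type*} [Fintype α] [DecidableEq α]
    [Fintype β] [DecidableEq β] :
    Matrix.GeneralLinearGroup α k × Matrix.GeneralLinearGroup β k →*
      Matrix.GeneralLinearGroup (α ⊕ β) k where
  toFun p :=
    ⟨Matrix.fromBlocks (p.1 : Matrix α α k) 0 0 (p.2 : Matrix β β k),
     Matrix.fromBlocks ((p.1⁻¹ : Matrix.GeneralLinearGroup α k) : Matrix α α k) 0 0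
       ((p.2⁻¹ : Matrix.GeneralLinearGroup β k) : Matrix β β k),
     by
      rw [Matrix.fromBlocks_multiply]
      simp only [Matrix.mul_zero, Matrix.zero_mul, add_zero, zero_add]
      rw [← Units.val_mul, ← Units.val_mul, mul_inv_cancel, mul_inv_cancel]
      simp [← Matrix.fromBlocks_one],
     by
      rw [Matrix.fromBlocks_multiply]
      simp only [Matrix.mul_zero, Matrix.zero_mul, add_zero, zero_add]
      rw [← Units.val_mul, ← Units.val_mul, inv_mul_cancel, inv_mul_cancel]
      simp [← Matrix.fromBlocks_one]⟩
  map_one' := by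
    ext : 1
    simp [← Matrix.fromBlocks_one]
  map_mul' p q := by
    ext : 1
    show Matrix.fromBlocks _ _ _ _ = Matrix.fromBlocks _ _ _ _ * Matrix.fromBlocks _ _ _ _
    rw [Matrix.fromBlocks_multiply]
    simp

/-- A homology: a pseudo-reflection that is not a transvection (it is then diagonalizable). -/
def IsHomology {k : Type*} [Field k] {ι : Type*} [Fintype ι] [DecidableEq ι]
    (M : Matrix.GeneralLinearGroup ι k) : Prop :=
  IsPseudoReflection M ∧ ¬ moveSpace M ≤ fixedSpace M

/-- `A` is (isomorphic to) a polynomial ring over `k`. -/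
def IsPolyAlg (k : Type*) [Field k] (A : Type*) [CommRing A] [Algebra k A] : Prop :=
  ∃ m : ℕ, Nonempty (A ≃ₐ[k] MvPolynomial (Fin m) k)

/-! ### Endomorphisms of a polynomial ring that are the identity to first order -/

section FirstOrder

/-- Modulo the next power of the ideal `I`, a ring endomorphism acts trivially on each power of `I`
as soon as it does so on the ring itself and on `I`. -/
lemma map_sub_self_mem_pow_succ {R : Type*} [CommRing R] {I : Ideal R} {θ : R →+* R}
    (h0 : ∀ x, θ x - x ∈ I) (h1 : ∀ x ∈ I, θ x - x ∈ I ^ 2) (d : ℕ) :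
    ∀ x ∈ I ^ d, θ x - x ∈ I ^ (d + 1) := by
  induction d with
  | zero => simpa using h0
  | succ d ih =>
    intro x hx
    rw [pow_succ'] at hx
    refine Submodule.mul_induction_on hx (fun a ha b hb => ?_) (fun a b ha hb => ?_)
    · have hθb : θ b ∈ I ^ d := by
        simpa using add_mem (Ideal.pow_le_pow_right (Nat.le_succ d) (ih b hb)) hb
      have e : θ (a * b) - a * b = (θ a - a) * θ b + a * (θ b - b) := by
        rw [map_mul]; ring
      rw [e]
      refine add_mem ?_ ?_
      · have := Ideal.mul_mem_mul (h1 a ha) hθb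
        rwa [← pow_add, add_comm 2 d] at this
      · rw [pow_succ']
        exact Ideal.mul_mem_mul ha (ih b hb)
    · rw [map_add, add_sub_add_comm]
      exact add_mem ha hb

variable {I : Type*}

lemma mem_idealOfVars_iff_constantCoeff (p : MvPolynomial I k) :
    p ∈ idealOfVars I k ↔ constantCoeff p = 0 := by
  rw [← pow_one (idealOfVars I k), mem_pow_idealOfVars_iff']
  simp [Finsupp.degree_eq_zero_iff, constantCoeff_eq]

lemma eq_zero_of_forall_mem_pow_idealOfVars {p : MvPolynomial I k}
    (hp : ∀ d, p ∈ idealOfVars I k ^ d) : p = 0 := by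
  ext x
  exact (mem_pow_idealOfVars_iff' _ _).1 (hp (x.degree + 1)) x (Nat.lt_succ_self _)

/-- An endomorphism of a polynomial ring which fixes the variables up to terms of order at least two
is injective. -/
lemma injective_of_map_X_sub_X_mem_sq (θ : MvPolynomial I k →ₐ[k] MvPolynomial I k)
    (h : ∀ i, θ (X i) - X i ∈ idealOfVars I k ^ 2) : Function.Injective θ := by
  have hX (i : I) : X i ∈ idealOfVars I k := Ideal.subset_span ⟨i, rfl⟩
  have hθX (i : I) : θ (X i) ∈ idealOfVars I k := by
    simpa using add_mem (Ideal.pow_le_self two_ne_zero (h i)) (hX i)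
  have h0 : ∀ x, θ x - x ∈ idealOfVars I k := by
    intro x
    induction x using MvPolynomial.induction_on with
    | C a => simp
    | add p q hp hq =>
      rw [map_add, add_sub_add_comm]
      exact add_mem hp hq
    | mul_X p i hp =>
      rw [map_mul]
      exact sub_mem (Ideal.mul_mem_left _ _ (hθX i)) (Ideal.mul_mem_left _ _ (hX i))
  have h1 : ∀ x ∈ idealOfVars I k, θ x - x ∈ idealOfVars I k ^ 2 := by
    intro x hx
    refine Submodule.span_induction ?_ ?_ ?_ ?_ hx
    · rintro _ ⟨i, rfl⟩
      exact h i
    · simp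
    · intro a b _ _ ha hb
      rw [map_add, add_sub_add_comm]
      exact add_mem ha hb
    · intro a b hb hb'
      have e : θ (a • b) - a • b = (θ a - a) * (θ b - b) + (θ a - a) * b + a * (θ b - b) := by
        rw [smul_eq_mul, map_mul]; ring
      rw [e]
      refine add_mem (add_mem (Ideal.mul_mem_left _ _ hb') ?_) (Ideal.mul_mem_left _ _ hb')
      rw [pow_two]
      exact Ideal.mul_mem_mul (h0 a) hb
  rw [injective_iff_map_eq_zero]
  intro p hp
  refine eq_zero_of_forall_mem_pow_idealOfVars fun d => ?_
  induction d with
  | zero => simp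
  | succ d ih =>
    simpa [hp] using map_sub_self_mem_pow_succ (θ := θ.toRingHom) h0 h1 d p ih

/-- A polynomial without constant term is a linear form up to terms of order at least two. -/
lemma exists_sub_linearCombination_X_mem_sq {p : MvPolynomial I k} (hp : p ∈ idealOfVars I k) :
    ∃ c : I →₀ k, p - Finsupp.linearCombination k (X : I → MvPolynomial I k) c ∈
      idealOfVars I k ^ 2 := by
  refine Submodule.span_induction ?_ ?_ ?_ ?_ hp
  · rintro _ ⟨i, rfl⟩
    exact ⟨Finsupp.single i 1, by simp⟩
  · exact ⟨0, by simp⟩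
  · rintro a b _ _ ⟨c, hc⟩ ⟨d, hd⟩
    refine ⟨c + d, ?_⟩
    rw [map_add, add_sub_add_comm]
    exact add_mem hc hd
  · rintro a b hb ⟨c, hc⟩
    refine ⟨constantCoeff a • c, ?_⟩
    have e : a • b - Finsupp.linearCombination k (X : I → MvPolynomial I k) (constantCoeff a • c)
        = (a - C (constantCoeff a)) * b +
          C (constantCoeff a) * (b - Finsupp.linearCombination k X c) := by
      rw [map_smul, smul_eq_mul, smul_eq_C_mul]; ring
    rw [e]
    refine add_mem ?_ (Ideal.mul_mem_left _ _ hc)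
    rw [pow_two]
    exact Ideal.mul_mem_mul ((mem_idealOfVars_iff_constantCoeff _).2 (by simp)) hb

end FirstOrder

/-! ### Graded subalgebras of polynomial rings -/

section Graded

universe u v

variable {σ : Type*}

/-- The elements without constant term of a subalgebra of a polynomial ring. -/
noncomputable def augmentation (A : Subalgebra k (MvPolynomial σ k)) :
    Submodule k (MvPolynomial σ k) :=
  Subalgebra.toSubmodule A ⊓ LinearMap.ker (aeval (0 : σ → k)).toLinearMap

lemma mem_augmentation {A : Subalgebra k (MvPolynomial σ k)} {p : MvPolynomial σ k} :
    p ∈ augmentation A ↔ p ∈ A ∧ constantCoeff p = 0 := by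
  simp [augmentation, aeval_zero]

lemma homogeneousComponent_mem_augmentation {A : Subalgebra k (MvPolynomial σ k)}
    (hA : ∀ p ∈ A, ∀ d, homogeneousComponent d p ∈ A) {p : MvPolynomial σ k}
    (hp : p ∈ augmentation A) (d : ℕ) : homogeneousComponent d p ∈ augmentation A := by
  rw [mem_augmentation] at hp ⊢
  refine ⟨hA p hp.1 d, ?_⟩
  rw [constantCoeff_eq, coeff_homogeneousComponent]
  split_ifs
  · exact hp.2
  · rfl

/-- Homogeneous elements which span the elements without constant term of a graded algebra, up to
decomposable elements, generate the algebra. -/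
lemma le_adjoin_of_augmentation_le {A : Subalgebra k (MvPolynomial σ k)}
    (hA : ∀ p ∈ A, ∀ d, homogeneousComponent d p ∈ A) {s : Set (MvPolynomial σ k)}
    (hs : ∀ f ∈ s, ∃ d, f.IsHomogeneous d)
    (hgen : augmentation A ≤ Submodule.span k s ⊔ augmentation A * augmentation A) :
    A ≤ Algebra.adjoin k s := by
  have key : ∀ d, ∀ p ∈ A, homogeneousComponent d p ∈ Algebra.adjoin k s := by
    intro d
    induction d using Nat.strong_induction_on with
    | _ d ih =>
    intro p hp
    rcases Nat.eq_zero_or_pos d with rfl | hd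
    · rw [homogeneousComponent_zero]
      exact Subalgebra.algebraMap_mem _ _
    have hspan : ∀ q ∈ Submodule.span k s, homogeneousComponent d q ∈ Algebra.adjoin k s := by
      intro q hq
      refine Submodule.span_induction ?_ ?_ ?_ ?_ hq
      · intro f hf
        obtain ⟨e, he⟩ := hs f hf
        rw [homogeneousComponent_of_mem he]
        split_ifs
        · exact Algebra.subset_adjoin hf
        · exact zero_mem _
      · simp
      · intro a b _ _ ha hb
        rw [map_add]
        exact add_mem ha hb
      · intro c a _ ha
        rw [map_smul]
        exact Subalgebra.smul_mem _ ha c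
    have hdec : ∀ q ∈ augmentation A * augmentation A,
        homogeneousComponent d q ∈ Algebra.adjoin k s := by
      intro q hq
      refine Submodule.mul_induction_on hq (fun u hu v hv => ?_) (fun a b ha hb => ?_)
      · rw [mem_augmentation] at hu hv
        rw [← sum_homogeneousComponent u, ← sum_homogeneousComponent v, Finset.sum_mul_sum, map_sum]
        refine sum_mem fun i _ => ?_
        rw [map_sum]
        refine sum_mem fun j _ => ?_
        rw [homogeneousComponent_of_mem ((homogeneousComponent_isHomogeneous i u).mul
          (homogeneousComponent_isHomogeneous j v))]
        split_ifs with hij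
        · rcases Nat.eq_zero_or_pos i with rfl | hi
          · simp [← constantCoeff_eq, hu.2]
          rcases Nat.eq_zero_or_pos j with rfl | hj
          · simp [← constantCoeff_eq, hv.2]
          exact mul_mem (ih i (by omega) u hu.1) (ih j (by omega) v hv.1)
        · exact zero_mem _
      · rw [map_add]
        exact add_mem ha hb
    have haug : homogeneousComponent d p ∈ augmentation A := by
      refine mem_augmentation.2 ⟨hA p hp d, ?_⟩
      rw [constantCoeff_eq, coeff_homogeneousComponent, if_neg]
      simpa using hd.ne
    obtain ⟨a, ha, b, hb, hab⟩ := Submodule.mem_sup.1 (hgen haug)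
    have hp' := homogeneousComponent_eq_self (homogeneousComponent_isHomogeneous d p)
    rw [← hp', ← hab, map_add]
    exact add_mem (hspan a ha) (hdec b hb)
  intro p hp
  rw [← sum_homogeneousComponent p]
  exact sum_mem fun d _ => key d p hp

/-- A graded subalgebra of a polynomial ring has a system of generators without constant terms
which is linearly independent modulo decomposable elements. -/
lemma exists_minimal_generators {k : Type u} [Field k] {σ : Type v}
    {A : Subalgebra k (MvPolynomial σ k)}
    (hA : ∀ p ∈ A, ∀ d, homogeneousComponent d p ∈ A) :
    ∃ (I : Type (max u v)) (f : I → MvPolynomial σ k), (∀ i, f i ∈ augmentation A) ∧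
      (∀ c : I →₀ k, Finsupp.linearCombination k f c ∈ augmentation A * augmentation A → c = 0) ∧
      Algebra.adjoin k (Set.range f) = A := by
  let Q := augmentation A * augmentation A
  let v : {p // p ∈ augmentation A ∧ ∃ d, p.IsHomogeneous d} → MvPolynomial σ k := fun p => p.1
  obtain ⟨I, a, -, hspan, hli⟩ := exists_linearIndependent' k (Q.mkQ ∘ v)
  refine ⟨I, v ∘ a, fun i => (a i).2.1, fun c hc => ?_, le_antisymm ?_ ?_⟩
  · rw [linearIndependent_iff] at hli
    refine hli c ?_
    rw [Function.comp_assoc, ← Finsupp.apply_linearCombination]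
    simpa [Q] using hc
  · refine Algebra.adjoin_le ?_
    rintro _ ⟨i, rfl⟩
    exact (mem_augmentation.1 (a i).2.1).1
  · refine le_adjoin_of_augmentation_le hA ?_ ?_
    · rintro _ ⟨i, rfl⟩
      exact (a i).2.2
    · have hv : augmentation A ≤ Submodule.span k (Set.range v) := by
        intro p hp
        rw [← sum_homogeneousComponent p]
        refine sum_mem fun d _ => Submodule.subset_span ?_
        exact ⟨⟨_, homogeneousComponent_mem_augmentation hA hp d, d,
          homogeneousComponent_isHomogeneous d p⟩, rfl⟩
      rw [Function.comp_assoc, Set.range_comp, Set.range_comp Q.mkQ v, ← Submodule.map_span,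
        ← Submodule.map_span] at hspan
      intro p hp
      have hp' : Q.mkQ p ∈ (Submodule.span k (Set.range (v ∘ a))).map Q.mkQ :=
        hspan ▸ Submodule.mem_map_of_mem (hv hp)
      obtain ⟨q, hq, hqp⟩ := hp'
      rw [Submodule.mkQ_apply, Submodule.mkQ_apply, Submodule.Quotient.eq] at hqp
      rw [← sub_sub_cancel q p]
      exact sub_mem (Submodule.mem_sup_left hq) (Submodule.mem_sup_right hqp)

/-- Relations between generators which are linearly independent modulo decomposable elements have
order at least two. -/
lemma mem_sq_idealOfVars_of_aeval_eq_zero {A : Subalgebra k (MvPolynomial σ k)} {I : Type*}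
    {f : I → MvPolynomial σ k} (hf : ∀ i, f i ∈ augmentation A)
    (hli : ∀ c : I →₀ k,
      Finsupp.linearCombination k f c ∈ augmentation A * augmentation A → c = 0)
    {p : MvPolynomial I k} (hp : aeval f p = 0) : p ∈ idealOfVars I k ^ 2 := by
  have hcc : ∀ q, constantCoeff (aeval f q) = constantCoeff q := by
    intro q
    induction q using MvPolynomial.induction_on with
    | C a => simp
    | add p q hp hq => simp only [map_add, hp, hq]
    | mul_X p i _ => simp [(mem_augmentation.1 (hf i)).2]
  have hmem : ∀ q ∈ idealOfVars I k, aeval f q ∈ augmentation A := by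
    intro q hq
    refine mem_augmentation.2 ⟨?_, (hcc q).trans ((mem_idealOfVars_iff_constantCoeff q).1 hq)⟩
    have hle : Algebra.adjoin k (Set.range f) ≤ A := by
      refine Algebra.adjoin_le ?_
      rintro _ ⟨i, rfl⟩
      exact (mem_augmentation.1 (hf i)).1
    rw [Algebra.adjoin_range_eq_range_aeval] at hle
    exact hle ⟨q, rfl⟩
  have hsq : ∀ q ∈ idealOfVars I k ^ 2, aeval f q ∈ augmentation A * augmentation A := by
    intro q hq
    rw [pow_two] at hq
    refine Submodule.mul_induction_on hq (fun a ha b hb => ?_) (fun a b ha hb => ?_)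
    · rw [map_mul]
      exact Submodule.mul_mem_mul (hmem a ha) (hmem b hb)
    · rw [map_add]
      exact add_mem ha hb
  obtain ⟨c, hc⟩ := exists_sub_linearCombination_X_mem_sq
    ((mem_idealOfVars_iff_constantCoeff p).2 (by rw [← hcc, hp, map_zero]))
  have hlin : aeval f (Finsupp.linearCombination k (X : I → MvPolynomial I k) c) =
      Finsupp.linearCombination k f c := by
    simp [Finsupp.linearCombination_apply, Finsupp.sum]
  have hc0 : c = 0 := by
    refine hli c ?_
    have := hsq _ hc
    rwa [map_sub, hp, zero_sub, neg_mem_iff, hlin] at this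
  simpa [hc0] using hc

/-- A graded subalgebra of a polynomial ring which is a retract of a polynomial algebra is itself a
polynomial algebra. -/
theorem isPolyAlg_of_retract {A : Subalgebra k (MvPolynomial σ k)}
    (hA : ∀ p ∈ A, ∀ d, homogeneousComponent d p ∈ A) {B : Type*} [CommRing B] [Algebra k B]
    (hB : IsPolyAlg k B) (i : A →ₐ[k] B) (ρ : B →ₐ[k] A) (hρ : ρ.comp i = AlgHom.id k A) :
    IsPolyAlg k A := by
  obtain ⟨n, ⟨e⟩⟩ := hB
  obtain ⟨I, f, hf, hli, hadj⟩ := exists_minimal_generators hA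
  rw [Algebra.adjoin_range_eq_range_aeval] at hadj
  have hlift : ∀ j : Fin n, ∃ q, aeval f q = (ρ (e.symm (X j)) : MvPolynomial σ k) := fun j =>
    (SetLike.ext_iff.1 hadj _).2 (ρ (e.symm (X j))).2
  choose g hg using hlift
  have hψ : (aeval f).comp (aeval g) = A.val.comp (ρ.comp e.symm.toAlgHom) := by
    ext1 j
    simpa using hg j
  let s : A →ₐ[k] MvPolynomial I k := (aeval g).comp (e.toAlgHom.comp i)
  have hs : ∀ a : A, aeval f (s a) = a := by
    intro a
    have h₁ := DFunLike.congr_fun hψ (e (i a))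
    have h₂ := DFunLike.congr_fun hρ a
    simp only [AlgHom.comp_apply, AlgHom.id_apply] at h₁ h₂
    simpa [s, h₂] using h₁
  let π : MvPolynomial I k →ₐ[k] A :=
    (aeval f).codRestrict A fun q => (SetLike.ext_iff.1 hadj _).1 ⟨q, rfl⟩
  have hinj : Function.Injective π := by
    have hθ : Function.Injective (s.comp π) := by
      refine injective_of_map_X_sub_X_mem_sq _ fun j => ?_
      refine mem_sq_idealOfVars_of_aeval_eq_zero hf hli ?_
      rw [map_sub, AlgHom.comp_apply, hs]
      exact sub_self _
    exact Function.Injective.of_comp (f := s) hθ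
  have hsurj : Function.Surjective π := fun a => ⟨s a, Subtype.ext (hs a)⟩
  have hfin : Finite I := by
    have hind : AlgebraicIndependent k fun j => e (i (π (X j))) := by
      have hcomp : aeval (fun j => e (i (π (X j)))) = e.toAlgHom.comp (i.comp π) := by
        ext1 j
        simp
      rw [AlgebraicIndependent, hcomp]
      have hi : Function.Injective i :=
        Function.LeftInverse.injective (g := ρ) fun a => DFunLike.congr_fun hρ a
      exact e.injective.comp (hi.comp hinj)
    have hle := hind.lift_cardinalMk_le_trdeg
    rw [MvPolynomial.trdeg_of_isDomain] at hle
    refine Cardinal.mk_lt_aleph0_iff.1 (Cardinal.lift_lt_aleph0.1 (hle.trans_lt ?_))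
    simp
  obtain ⟨N, ⟨eN⟩⟩ := Finite.exists_equiv_fin I
  exact ⟨N, ⟨(AlgEquiv.ofBijective π ⟨hinj, hsurj⟩).symm.trans (renameEquiv k eN)⟩⟩

end Graded

/-! ### Fixed points of tensor products -/

section TensorFixed

open TensorProduct

variable {M N : Type*} [AddCommGroup M] [Module k M] [AddCommGroup N] [Module k N]

/-- An element of `M ⊗ N` fixed by operators on the left factor lies in `W ⊗ N`, where `W` contains
the common fixed points of these operators. -/
lemma mem_range_rTensor_of_fixed {S : Set (M →ₗ[k] M)} {W : Submodule k M}
    (hW : ∀ x, (∀ g ∈ S, g x = x) → x ∈ W) {x : M ⊗[k] N}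
    (hx : ∀ g ∈ S, g.rTensor N x = x) : x ∈ LinearMap.range (W.subtype.rTensor N) := by
  classical
  let b := Module.Basis.ofVectorSpace k N
  obtain ⟨c, rfl⟩ := TensorProduct.eq_repr_basis_right b x
  have hc : ∀ i, c i ∈ W := by
    intro i
    refine hW _ fun g hg => ?_
    by_cases hi : c i = 0
    · rw [hi, map_zero]
    have h := congrArg (fun z => equivFinsuppOfBasisRight b z i) (hx g hg)
    simpa [Finsupp.sum, Finsupp.finsetSum_apply, equivFinsuppOfBasisRight_apply_tmul_apply,
      Finsupp.single_apply, hi] using h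
  refine Submodule.sum_mem _ fun i _ => ⟨(⟨c i, hc i⟩ : W) ⊗ₜ b i, ?_⟩
  simp

lemma mem_range_lTensor_of_fixed {S : Set (N →ₗ[k] N)} {W : Submodule k N}
    (hW : ∀ x, (∀ g ∈ S, g x = x) → x ∈ W) {x : M ⊗[k] N}
    (hx : ∀ g ∈ S, g.lTensor M x = x) : x ∈ LinearMap.range (W.subtype.lTensor M) := by
  have h := mem_range_rTensor_of_fixed (N := M) hW (x := TensorProduct.comm k M N x) fun g hg => by
    rw [← LinearMap.comm_comp_lTensor_comp_comm_eq]
    simp [hx g hg]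
  obtain ⟨y, hy⟩ := h
  refine ⟨TensorProduct.comm k W M y, ?_⟩
  rw [← LinearMap.comm_comp_rTensor_comp_comm_eq]
  simp [hy]

/-- Fixed points of a tensor product under operators acting on the two factors separately. -/
lemma mem_range_map_of_fixed {S : Set (M →ₗ[k] M)} {S' : Set (N →ₗ[k] N)} {W : Submodule k M}
    {W' : Submodule k N} (hW : ∀ x, (∀ g ∈ S, g x = x) → x ∈ W)
    (hW' : ∀ x, (∀ g ∈ S', g x = x) → x ∈ W') {x : M ⊗[k] N}
    (hx : ∀ g ∈ S, g.rTensor N x = x) (hx' : ∀ g ∈ S', g.lTensor M x = x) :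
    x ∈ LinearMap.range (TensorProduct.map W.subtype W'.subtype) := by
  obtain ⟨y, rfl⟩ := mem_range_rTensor_of_fixed hW hx
  have hinj : Function.Injective (W.subtype.rTensor N) :=
    Module.Flat.rTensor_preserves_injective_linearMap _ W.injective_subtype
  obtain ⟨z, rfl⟩ := mem_range_lTensor_of_fixed (M := W) hW' (x := y) fun g hg => by
    apply hinj
    have h := hx' g hg
    rwa [← LinearMap.comp_apply, LinearMap.lTensor_comp_rTensor, ← LinearMap.rTensor_comp_lTensor,
      LinearMap.comp_apply] at h
  exact ⟨z, by rw [← LinearMap.rTensor_comp_lTensor]; rfl⟩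

end TensorFixed

/-! ### Invariants of matrix groups -/

section Invariants

open TensorProduct

lemma galAct_X (M : Matrix.GeneralLinearGroup ι k) (i : ι) :
    galAct M (X i) =
      ∑ j, (((M⁻¹ : Matrix.GeneralLinearGroup ι k) : Matrix ι ι k) i j) • X j := by
  simp [galAct]

lemma galAct_one : galAct (1 : Matrix.GeneralLinearGroup ι k) = AlgHom.id k _ := by
  ext1 i
  simp [galAct_X, Matrix.one_apply]

lemma galAct_isHomogeneous (M : Matrix.GeneralLinearGroup ι k) {p : MvPolynomial ι k} {d : ℕ}
    (hp : p.IsHomogeneous d) : (galAct M p).IsHomogeneous d := by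
  rw [← one_mul d]
  refine hp.aeval _ fun i => IsHomogeneous.sum _ _ _ fun j _ => ?_
  rw [smul_eq_C_mul, ← zero_add 1]
  exact (isHomogeneous_C _ _).mul (isHomogeneous_X _ _)

lemma homogeneousComponent_galAct (M : Matrix.GeneralLinearGroup ι k) (p : MvPolynomial ι k)
    (d : ℕ) : homogeneousComponent d (galAct M p) = galAct M (homogeneousComponent d p) := by
  induction p using MvPolynomial.induction_on' with
  | monomial u a =>
    have h : (monomial u a).IsHomogeneous u.degree := isHomogeneous_monomial a rfl
    rw [homogeneousComponent_of_mem h, homogeneousComponent_of_mem (galAct_isHomogeneous M h)]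
    split_ifs
    · rfl
    · rw [map_zero]
  | add p q hp hq => simp only [map_add, hp, hq]

lemma homogeneousComponent_mem_invariants (G : Subgroup (Matrix.GeneralLinearGroup ι k)) :
    ∀ p ∈ invariants G, ∀ d, homogeneousComponent d p ∈ invariants G := by
  intro p hp d σ hσ
  rw [← homogeneousComponent_galAct, hp σ hσ]

variable {α β : Type*} [Fintype α] [DecidableEq α] [Fintype β] [DecidableEq β]

/-- A block-diagonal matrix acts on `k[V ⊕ W] = k[V] ⊗ k[W]` factor by factor. -/
lemma galAct_blockHom_tensorEquivSum (τ : Matrix.GeneralLinearGroup α k)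
    (δ : Matrix.GeneralLinearGroup β k) (x : MvPolynomial α k ⊗[k] MvPolynomial β k) :
    galAct (blockHom (τ, δ)) (tensorEquivSum k α β k x) =
      tensorEquivSum k α β k (Algebra.TensorProduct.map (galAct τ) (galAct δ) x) := by
  have hinv : (((blockHom (τ, δ))⁻¹ : Matrix.GeneralLinearGroup (α ⊕ β) k) :
      Matrix (α ⊕ β) (α ⊕ β) k) = Matrix.fromBlocks
        ((τ⁻¹ : Matrix.GeneralLinearGroup α k) : Matrix α α k) 0 0
        ((δ⁻¹ : Matrix.GeneralLinearGroup β k) : Matrix β β k) := rfl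
  have h : (galAct (blockHom (τ, δ))).comp (tensorEquivSum k α β k).toAlgHom =
      (tensorEquivSum k α β k).toAlgHom.comp
        (Algebra.TensorProduct.map (galAct τ) (galAct δ)) := by
    ext i
    · simp [galAct_X, hinv, TensorProduct.sum_tmul, ← TensorProduct.smul_tmul']
    · simp [galAct_X, hinv, TensorProduct.tmul_sum]
  exact DFunLike.congr_fun h x

/-- The multiplication map `k[V]^T ⊗ k[W]^D → k[V ⊕ W]`. -/
noncomputable def invariantsTensorHom (T : Subgroup (Matrix.GeneralLinearGroup α k))
    (D : Subgroup (Matrix.GeneralLinearGroup β k)) :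
    invariants T ⊗[k] invariants D →ₐ[k] MvPolynomial (α ⊕ β) k :=
  (tensorEquivSum k α β k).toAlgHom.comp
    (Algebra.TensorProduct.map (invariants T).val (invariants D).val)

lemma invariantsTensorHom_injective (T : Subgroup (Matrix.GeneralLinearGroup α k))
    (D : Subgroup (Matrix.GeneralLinearGroup β k)) :
    Function.Injective (invariantsTensorHom T D) :=
  (tensorEquivSum k α β k).injective.comp
    (TensorProduct.map_injective_of_flat_flat (invariants T).val.toLinearMap
      (invariants D).val.toLinearMap Subtype.val_injective Subtype.val_injective)

lemma invariantsTensorHom_range (T : Subgroup (Matrix.GeneralLinearGroup α k))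
    (D : Subgroup (Matrix.GeneralLinearGroup β k)) :
    (invariantsTensorHom T D).range = invariants ((T.prod D).map blockHom) := by
  refine le_antisymm ?_ fun p hp => ?_
  · rintro _ ⟨x, rfl⟩ _ ⟨⟨τ, δ⟩, ⟨hτ, hδ⟩, rfl⟩
    change galAct _ (tensorEquivSum k α β k _) = tensorEquivSum k α β k _
    rw [galAct_blockHom_tensorEquivSum]
    congr 1
    have h : (Algebra.TensorProduct.map (galAct τ) (galAct δ)).comp
        (Algebra.TensorProduct.map (invariants T).val (invariants D).val) =
        Algebra.TensorProduct.map (invariants T).val (invariants D).val := by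
      ext a
      · simpa using congrArg (· ⊗ₜ[k] (1 : MvPolynomial β k)) (a.2 τ hτ)
      · simpa using congrArg ((1 : MvPolynomial α k) ⊗ₜ[k] ·) (a.2 δ hδ)
    exact DFunLike.congr_fun h x
  · obtain ⟨x, rfl⟩ := (tensorEquivSum k α β k).surjective p
    have hfix : ∀ τ ∈ T, ∀ δ ∈ D,
        Algebra.TensorProduct.map (galAct τ) (galAct δ) x = x := by
      intro τ hτ δ hδ
      apply (tensorEquivSum k α β k).injective
      rw [← galAct_blockHom_tensorEquivSum]
      exact hp _ ⟨(τ, δ), ⟨hτ, hδ⟩, rfl⟩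
    obtain ⟨y, hy⟩ := mem_range_map_of_fixed
      (S := (fun τ => (galAct τ).toLinearMap) '' T) (S' := (fun δ => (galAct δ).toLinearMap) '' D)
      (W := Subalgebra.toSubmodule (invariants T)) (W' := Subalgebra.toSubmodule (invariants D))
      (x := x) (fun q hq τ hτ => hq _ ⟨τ, hτ, rfl⟩) (fun q hq δ hδ => hq _ ⟨δ, hδ, rfl⟩)
      (by
        rintro _ ⟨τ, hτ, rfl⟩
        have h := hfix τ hτ 1 (one_mem D)
        rwa [galAct_one] at h)
      (by
        rintro _ ⟨δ, hδ, rfl⟩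
        have h := hfix 1 (one_mem T) δ hδ
        rwa [galAct_one] at h)
    exact ⟨y, congrArg (tensorEquivSum k α β k) hy⟩

/-- The isomorphism `k[V ⊕ W]^(T × D) ≃ k[V]^T ⊗ k[W]^D`. -/
noncomputable def invariantsProdEquiv (T : Subgroup (Matrix.GeneralLinearGroup α k))
    (D : Subgroup (Matrix.GeneralLinearGroup β k)) :
    invariants ((T.prod D).map blockHom) ≃ₐ[k] invariants T ⊗[k] invariants D :=
  (Subalgebra.equivOfEq _ _ (invariantsTensorHom_range T D).symm).trans
    (AlgEquiv.ofInjective _ (invariantsTensorHom_injective T D)).symm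

end Invariants

section IsPolyAlg

open TensorProduct

variable {A B : Type*} [CommRing A] [Algebra k A] [CommRing B] [Algebra k B]

lemma IsPolyAlg.congr (h : IsPolyAlg k A) (e : A ≃ₐ[k] B) : IsPolyAlg k B := by
  obtain ⟨n, ⟨f⟩⟩ := h
  exact ⟨n, ⟨e.symm.trans f⟩⟩

lemma IsPolyAlg.tensorProduct (hA : IsPolyAlg k A) (hB : IsPolyAlg k B) :
    IsPolyAlg k (A ⊗[k] B) := by
  obtain ⟨n, ⟨f⟩⟩ := hA
  obtain ⟨l, ⟨g⟩⟩ := hB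
  exact ⟨n + l, ⟨((Algebra.TensorProduct.congr f g).trans
    (tensorEquivSum k (Fin n) (Fin l) k)).trans (renameEquiv k finSumFinEquiv)⟩⟩

/-- A graded tensor factor of a polynomial algebra, with augmented complementary factor, is a
polynomial algebra. -/
lemma IsPolyAlg.of_tensorProduct_left {σ : Type*} {A : Subalgebra k (MvPolynomial σ k)}
    (hA : ∀ p ∈ A, ∀ d, homogeneousComponent d p ∈ A) (ε : B →ₐ[k] k)
    (h : IsPolyAlg k (A ⊗[k] B)) : IsPolyAlg k A := by
  refine isPolyAlg_of_retract hA h Algebra.TensorProduct.includeLeft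
    ((Algebra.TensorProduct.rid k k A).toAlgHom.comp
      (Algebra.TensorProduct.map (AlgHom.id k A) ε)) ?_
  ext1 a
  simp

end IsPolyAlg

/-- Let `G = T × D < GL(V)` be a finite abelian pseudo-reflection group,
with `T` the transvection subgroup acting on `V^D` and `D` the homology subgroup acting on
`V_D`, realized in coordinates adapted to the `kG`-module decomposition `V = V^D ⊕ V_D`
(so `G` is the block-diagonal product of `T < GL(V^D)` and `D < GL(V_D)`). Then
`k[V]^G ≅ k[V^D]^T ⊗_k k[V_D]^D` as `k`-algebras; consequently `k[V]^G` is a polynomial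
ring if and only if both `k[V^D]^T` and `k[V_D]^D` are polynomial rings. -/
theorem statement12 {k : Type*} [Field k] {m r : ℕ}
    (T : Subgroup (Matrix.GeneralLinearGroup (Fin m) k)) [Finite ↥T]
    (D : Subgroup (Matrix.GeneralLinearGroup (Fin r) k)) [Finite ↥D]
    (hTab : ∀ a ∈ T, ∀ b ∈ T, a * b = b * a)
    (hDab : ∀ a ∈ D, ∀ b ∈ D, a * b = b * a)
    (hTgen : Subgroup.closure {τ | τ ∈ T ∧ IsTransvection τ} = T)
    (hDgen : Subgroup.closure {σ | σ ∈ D ∧ IsHomology σ} = D)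
    (G : Subgroup (Matrix.GeneralLinearGroup (Fin m ⊕ Fin r) k))
    (hG : G = (T.prod D).map blockHom) :
    Nonempty (↥(invariants G) ≃ₐ[k]
        TensorProduct k ↥(invariants T) ↥(invariants D)) ∧
    (IsPolyAlg k ↥(invariants G) ↔
      IsPolyAlg k ↥(invariants T) ∧ IsPolyAlg k ↥(invariants D)) := by
  subst hG
  let e := invariantsProdEquiv T D
  refine ⟨⟨e⟩, fun h => ⟨?_, ?_⟩, fun h => (h.1.tensorProduct h.2).congr e.symm⟩
  · exact IsPolyAlg.of_tensorProduct_left (homogeneousComponent_mem_invariants T)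
      ((aeval (0 : Fin r → k)).comp (invariants D).val) (h.congr e)
  · exact IsPolyAlg.of_tensorProduct_left (homogeneousComponent_mem_invariants D)
      ((aeval (0 : Fin m → k)).comp (invariants T).val)
      (h.congr (e.trans (Algebra.TensorProduct.comm k (invariants T) (invariants D))))
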